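/- arXiv:2601.09643 — 5 statements merged into one kernel-verified Lean document; each statement's English description precedes it below -/
import Mathlib

section
/- Let G be a locally finite group, φ an endomorphism of G, and F a finite subgroup of G. Then the sequence a_n = log|T_n(φ,F)| is subadditive (a_{n+m} ≤ a_n + a_m for all n,m ≥ 1); consequently the limit lim_{n→∞} (1/n)·log|T_n(φ,F)| exists and equals inf_{n≥1} (1/n)·log|T_n(φ,F)|. -/
open scoped Pointwise ENNReal

/-- A group is *locally finite* if every finitely generated subgroup is finite. -/
def IsLocallyFinite (G : Type*) [Group G] : Prop :=
  ∀ S : Set G, S.Finite → (Subgroup.closure S : Set G).Finite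

namespace AlgEntropy

variable {G : Type*} [Group G]

/-- `entTraj φ F n` is the `n`-th trajectory `T_n(φ,F) = F·φ(F)···φ^{n-1}(F)`
(with `T_0 = {1}`). -/
def entTraj (φ : G →* G) (F : Set G) : ℕ → Set G
  | 0 => {1}
  | n + 1 => entTraj φ F n * (⇑φ)^[n] '' F

/-- The algebraic entropy of `φ` with respect to a subgroup `F`:
`H(φ,F) = lim_n (1/n)·log|T_n(φ,F)|` (the limit exists when `G` is locally
finite and `F` is finite, and then it coincides with this `limsup`). -/
noncomputable def entH (φ : G →* G) (F : Subgroup G) : ℝ :=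
  Filter.limsup (fun n : ℕ => Real.log (entTraj φ (F : Set G) n).ncard / n) Filter.atTop

/-- The algebraic entropy `h(φ) = sup { H(φ,F) : F ≤ G finite }`, valued in `[0,∞]`. -/
noncomputable def algEnt (φ : G →* G) : ℝ≥0∞ :=
  ⨆ (F : Subgroup G) (_ : (F : Set G).Finite), ENNReal.ofReal (entH φ F)

/-- The restriction of an endomorphism `φ` to a `φ`-invariant subgroup `H`. -/
def endRestrict (φ : G →* G) (H : Subgroup G) (hH : H ≤ H.comap φ) : H →* H :=
  (φ.domRestrict H).codRestrict H (fun x => hH x.2)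

/-- The entropy of the endomorphism induced by `φ` on the quotient `G ⧸ H`. -/
noncomputable def entQuot (φ : G →* G) (H : Subgroup G) (hN : H.Normal)
    (hH : H ≤ H.comap φ) : ℝ≥0∞ :=
  letI := hN
  algEnt (QuotientGroup.map H H φ hH)

/-- The Addition Theorem `AT(G,φ,H)`:
`h(φ) = h(φ↾_H) + h(φ̄)` where `φ̄` is induced by `φ` on `G ⧸ H`. -/
def AT (φ : G →* G) (H : Subgroup G) (hN : H.Normal) (hH : H ≤ H.comap φ) : Prop :=
  algEnt φ = algEnt (endRestrict φ H hH) + entQuot φ H hN hH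

lemma commutator_le_comap (φ : G →* G) :
    commutator G ≤ (commutator G).comap φ := by
  rw [← Subgroup.map_le_iff_le_comap]
  calc Subgroup.map φ (commutator G) = ⁅Subgroup.map φ ⊤, Subgroup.map φ ⊤⁆ :=
        Subgroup.map_commutator ⊤ ⊤ φ
    _ ≤ commutator G := Subgroup.commutator_mono le_top le_top

lemma normal_of_le_center {N : Subgroup G} (h : N ≤ Subgroup.center G) : N.Normal := by
  constructor
  intro n hn g
  have hc := Subgroup.mem_center_iff.mp (h hn) g
  have : g * n * g⁻¹ = n := by
    rw [hc]; group
  rwa [this]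

lemma center_le_comap_equiv (φ : G ≃* G) :
    Subgroup.center G ≤ (Subgroup.center G).comap φ.toMonoidHom := by
  intro x hx
  simp only [Subgroup.mem_comap]
  refine Subgroup.mem_center_iff.mpr fun g => ?_
  have hg : φ (φ.symm g) = g := φ.apply_symm_apply g
  calc g * φ x = φ (φ.symm g) * φ x := by rw [hg]
    _ = φ (φ.symm g * x) := by rw [map_mul]
    _ = φ (x * φ.symm g) := by rw [Subgroup.mem_center_iff.mp hx (φ.symm g)]
    _ = φ x * g := by rw [map_mul, hg]

lemma lowerCentralSeries_le_comap (φ : G →* G) (n : ℕ) :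
    Subgroup.lowerCentralSeries (⊤ : Subgroup G) n ≤
      (Subgroup.lowerCentralSeries (⊤ : Subgroup G) n).comap φ := by
  rw [← Subgroup.map_le_iff_le_comap]
  induction n with
  | zero => exact le_top
  | succ n ih =>
      show Subgroup.map φ ⁅Subgroup.lowerCentralSeries (⊤ : Subgroup G) n, ⊤⁆ ≤
        ⁅Subgroup.lowerCentralSeries (⊤ : Subgroup G) n, ⊤⁆
      rw [Subgroup.map_commutator]
      exact Subgroup.commutator_mono ih le_top

lemma upperCentralSeries_le_comap (φ : G ≃* G) (n : ℕ) :
    upperCentralSeries G n ≤ (upperCentralSeries G n).comap φ.toMonoidHom := by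
  have := comap_upperCentralSeries φ n
  -- `(upperCentralSeries G n).comap φ = upperCentralSeries G n`
  exact le_of_eq this.symm

end AlgEntropy

namespace AlgEntropy

lemma entTraj_add {G : Type*} [Group G] (φ : G →* G) (F : Set G) (n m : ℕ) :
    entTraj φ F (n + m) = entTraj φ F n * ((⇑φ)^[n] '' entTraj φ F m) := by
  induction m with
  | zero => simp [entTraj, iterate_map_one]
  | succ m ih =>
    rw [← add_assoc]
    simp only [entTraj]
    rw [ih, mul_assoc]
    congr 1
    have h : (⇑φ)^[n + m] '' F = (⇑φ)^[n] '' ((⇑φ)^[m] '' F) := by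
      rw [Function.iterate_add, Set.image_comp]
    rw [h]
    ext x
    simp only [Set.mem_mul, Set.mem_image]
    constructor
    · rintro ⟨_, ⟨a, ha, rfl⟩, _, ⟨b, hb, rfl⟩, rfl⟩
      exact ⟨a * b, ⟨a, ha, b, hb, rfl⟩, iterate_map_mul φ n a b⟩
    · rintro ⟨_, ⟨a, ha, b, hb, rfl⟩, rfl⟩
      exact ⟨_, ⟨a, ha, rfl⟩, _, ⟨b, hb, rfl⟩, (iterate_map_mul φ n a b).symm⟩

lemma entTraj_finite {G : Type*} [Group G] (φ : G →* G) {F : Set G} (hF : F.Finite) (n : ℕ) :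
    (entTraj φ F n).Finite := by
  induction n with
  | zero => exact Set.finite_singleton 1
  | succ n ih => exact ih.mul (hF.image _)

lemma entTraj_nonempty {G : Type*} [Group G] (φ : G →* G) {F : Set G} (hF : F.Nonempty) (n : ℕ) :
    (entTraj φ F n).Nonempty := by
  induction n with
  | zero => exact Set.singleton_nonempty 1
  | succ n ih => exact ih.mul (hF.image _)

lemma entTraj_log_subadditive {G : Type*} [Group G] (φ : G →* G) {F : Set G}
    (hF : F.Finite) (hne : F.Nonempty) :
    Subadditive (fun n => Real.log ((entTraj φ F n).ncard : ℝ)) := by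
  intro n m
  have pos : ∀ k, 0 < (entTraj φ F k).ncard := fun k =>
    (Set.ncard_pos (entTraj_finite φ hF k)).2 (entTraj_nonempty φ hne k)
  have pos' : ∀ k, ((entTraj φ F k).ncard : ℝ) ≠ 0 := fun k => by
    exact_mod_cast (pos k).ne'
  show Real.log _ ≤ Real.log _ + Real.log _
  rw [← Real.log_mul (pos' n) (pos' m)]
  apply Real.log_le_log (by exact_mod_cast pos _)
  have h1 : (entTraj φ F (n + m)).ncard ≤
      (entTraj φ F n).ncard * ((⇑φ)^[n] '' entTraj φ F m).ncard := by
    rw [entTraj_add]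
    simpa only [Nat.card_coe_set_eq] using
      Set.natCard_mul_le (s := entTraj φ F n) (t := (⇑φ)^[n] '' entTraj φ F m)
  have h2 := Set.ncard_image_le (f := (⇑φ)^[n]) (entTraj_finite φ hF m)
  exact_mod_cast h1.trans (Nat.mul_le_mul_left _ h2)

end AlgEntropy

/-- For a locally finite group `G`, an endomorphism `φ` and a finite
subgroup `F`, the sequence `a_n = log|T_n(φ,F)|` is subadditive, and consequently
`(1/n)·a_n` converges to `inf_{n ≥ 1} a_n / n`. -/
theorem traj_subadditive_and_tendsto {G : Type*} [Group G]
    (hG : IsLocallyFinite G) (φ : G →* G) (F : Subgroup G) (hF : (F : Set G).Finite) :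
    (∀ n m : ℕ, 1 ≤ n → 1 ≤ m →
      Real.log ((AlgEntropy.entTraj φ (F : Set G) (n + m)).ncard : ℝ) ≤
        Real.log ((AlgEntropy.entTraj φ (F : Set G) n).ncard : ℝ) +
        Real.log ((AlgEntropy.entTraj φ (F : Set G) m).ncard : ℝ)) ∧
    Filter.Tendsto
      (fun n : ℕ => Real.log ((AlgEntropy.entTraj φ (F : Set G) n).ncard : ℝ) / n)
      Filter.atTop
      (nhds (⨅ n : ℕ+,
        Real.log ((AlgEntropy.entTraj φ (F : Set G) (n : ℕ)).ncard : ℝ) / (n : ℕ))) := by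
  have hs := AlgEntropy.entTraj_log_subadditive φ hF ⟨1, F.one_mem⟩
  refine ⟨fun n m _ _ => hs n m, ?_⟩
  have hb : BddBelow (Set.range fun n : ℕ =>
      Real.log ((AlgEntropy.entTraj φ (F : Set G) n).ncard : ℝ) / n) := by
    refine ⟨0, ?_⟩
    rintro _ ⟨n, rfl⟩
    exact div_nonneg (Real.log_natCast_nonneg _) (Nat.cast_nonneg _)
  have ht := hs.tendsto_lim hb
  rw [Subadditive.lim] at ht
  convert ht using 2
  rw [iInf]
  congr 1
  ext x
  simp only [Set.mem_range, Set.mem_image, Set.mem_Ici]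
  constructor
  · rintro ⟨n, rfl⟩
    exact ⟨n, n.pos, rfl⟩
  · rintro ⟨n, hn, rfl⟩
    exact ⟨⟨n, hn⟩, rfl⟩
end

section
/- Let G be a locally finite group, let φ be an endomorphism of G, and let N be a φ-invariant subgroup of G contained in the center Z(G). Then h(φ) = h(φ↾_N) + h(φ̄), where φ̄ is the endomorphism induced by φ on G/N. -/
open scoped Pointwise ENNReal

namespace AlgEntropy

section aux

variable {G : Type*} [Group G]

lemma traj_image {H : Type*} [Group H] (φ : G →* G) (ψ : H →* H) (f : G →* H)
    (h : ∀ x, f (φ x) = ψ (f x)) (F : Set G) (n : ℕ) :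
    f '' entTraj φ F n = entTraj ψ (f '' F) n := by
  induction n with
  | zero => simp [entTraj]
  | succ n ih =>
    have hs : Function.Semiconj f φ ψ := h
    simp only [entTraj]
    rw [Set.image_mul, ih, Set.image_image, Set.image_image]
    congr 1
    apply Set.image_congr
    intro x _
    exact hs.iterate_right n x

lemma traj_add (φ : G →* G) (F : Set G) (n m : ℕ) :
    entTraj φ F (n + m) = entTraj φ F n * (⇑φ)^[n] '' entTraj φ F m := by
  induction m with
  | zero => simp [entTraj]
  | succ m ih =>
    have h1 : ∀ s t : Set G, (⇑φ)^[n] '' (s * t) = (⇑φ)^[n] '' s * (⇑φ)^[n] '' t := by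
      intro s t
      exact Set.image_image2_distrib (fun a b => iterate_map_mul φ n a b)
    rw [← add_assoc]
    simp only [entTraj]
    rw [ih, h1, mul_assoc, Set.image_image]
    simp only [Function.iterate_add_apply]

lemma traj_finite (φ : G →* G) {F : Set G} (hF : F.Finite) (n : ℕ) :
    (entTraj φ F n).Finite := by
  induction n with
  | zero => exact Set.finite_singleton _
  | succ n ih => exact ih.mul (hF.image _)

lemma traj_one_mem (φ : G →* G) {F : Set G} (hF : (1 : G) ∈ F) (n : ℕ) :
    (1 : G) ∈ entTraj φ F n := by
  induction n with
  | zero => exact Set.mem_singleton _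
  | succ n ih => exact ⟨1, ih, 1, ⟨1, hF, iterate_map_one φ n⟩, mul_one 1⟩

lemma traj_mono_nat (φ : G →* G) {F : Set G} (hF : (1 : G) ∈ F) {n m : ℕ} (h : n ≤ m) :
    entTraj φ F n ⊆ entTraj φ F m := by
  obtain ⟨k, rfl⟩ := Nat.exists_eq_add_of_le h
  rw [traj_add]
  intro x hx
  exact ⟨x, hx, 1, ⟨1, traj_one_mem φ hF k, iterate_map_one φ n⟩, mul_one x⟩

lemma traj_ncard_pos (φ : G →* G) {F : Set G} (hF : F.Finite) (h1 : (1 : G) ∈ F) (n : ℕ) :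
    0 < (entTraj φ F n).ncard :=
  (Set.ncard_pos (traj_finite φ hF n)).2 ⟨1, traj_one_mem φ h1 n⟩

lemma ncard_mul_le' {s t : Set G} : (s * t).ncard ≤ s.ncard * t.ncard := Set.natCard_mul_le

lemma traj_subadd (φ : G →* G) {F : Set G} (hF : F.Finite) (h1 : (1 : G) ∈ F) :
    Subadditive (fun n => Real.log (entTraj φ F n).ncard) := by
  intro n m
  have hn := traj_ncard_pos φ hF h1 n
  have hm := traj_ncard_pos φ hF h1 m
  rw [← Real.log_mul (by positivity) (by positivity)]
  apply Real.log_le_log (by exact_mod_cast traj_ncard_pos φ hF h1 _)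
  norm_cast
  rw [traj_add]
  exact ncard_mul_le'.trans (Nat.mul_le_mul_left _ (Set.ncard_image_le (traj_finite φ hF m)))

lemma entH_tendsto (φ : G →* G) (F : Subgroup G) (hF : (F : Set G).Finite) :
    Filter.Tendsto (fun n : ℕ => Real.log (entTraj φ (F : Set G) n).ncard / n) Filter.atTop
      (nhds (entH φ F)) := by
  have h := (traj_subadd φ hF F.one_mem).tendsto_lim (by
    refine ⟨0, ?_⟩
    rintro _ ⟨n, rfl⟩
    exact div_nonneg (Real.log_natCast_nonneg _) (Nat.cast_nonneg _))
  have h2 : entH φ F = (traj_subadd φ hF F.one_mem).lim := h.limsup_eq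
  rw [h2]
  exact h

lemma traj_subset_subgroup (φ : G →* G) (N : Subgroup G) (hφ : N ≤ N.comap φ) {F : Set G}
    (hF : F ⊆ N) (n : ℕ) : entTraj φ F n ⊆ N := by
  have hit : ∀ n : ℕ, ∀ x ∈ N, (⇑φ)^[n] x ∈ N := by
    intro n
    induction n with
    | zero => intro x hx; exact hx
    | succ n ih => intro x hx; exact ih _ (hφ hx)
  induction n with
  | zero => intro x hx; rw [Set.mem_singleton_iff.1 hx]; exact N.one_mem
  | succ n ih =>
    rintro _ ⟨a, ha, _, ⟨b, hb, rfl⟩, rfl⟩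
    exact N.mul_mem (ih ha) (hit n b (hF hb))

lemma iter_mem (φ : G →* G) (N : Subgroup G) (hφ : N ≤ N.comap φ) (n : ℕ) (x : G)
    (hx : x ∈ N) : (⇑φ)^[n] x ∈ N := by
  induction n generalizing x with
  | zero => exact hx
  | succ n ih => exact ih _ (hφ hx)

lemma exists_section (N : Subgroup G) [N.Normal] {A : Set G} (hA : A.Finite) :
    ∃ S ⊆ A, Set.InjOn (QuotientGroup.mk' N) S ∧
      QuotientGroup.mk' N '' S = QuotientGroup.mk' N '' A ∧
      S.ncard = (QuotientGroup.mk' N '' A).ncard := by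
  obtain ⟨S, hS, hb⟩ := Set.exists_subset_bijOn A (QuotientGroup.mk' N)
  refine ⟨S, hS, hb.injOn, hb.image_eq, ?_⟩
  rw [← hb.image_eq, Set.ncard_image_of_injOn hb.injOn]

lemma lower_card (N : Subgroup G) [N.Normal] {A B : Set G} (hA : A ⊆ N) (hAf : A.Finite)
    (hB : B.Finite) : A.ncard * (QuotientGroup.mk' N '' B).ncard ≤ (A * B).ncard := by
  obtain ⟨S, hS, hi, -, hc⟩ := exists_section N hB
  rw [← hc, ← Set.ncard_prod]
  refine Set.ncard_le_ncard_of_injOn (fun p => p.1 * p.2) ?_ ?_ (hAf.mul hB)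
  · rintro ⟨a, s⟩ ⟨ha, hs⟩
    exact ⟨a, ha, s, hS hs, rfl⟩
  · rintro ⟨a, s⟩ ⟨ha, hs⟩ ⟨a', s'⟩ ⟨ha', hs'⟩ h
    simp only at ha hs ha' hs' h
    have e : ∀ a ∈ A, QuotientGroup.mk' N a = 1 := fun a ha =>
      (QuotientGroup.eq_one_iff a).2 (hA ha)
    have h1 := congrArg (QuotientGroup.mk' N) h
    rw [map_mul, map_mul, e a ha, e a' ha', one_mul, one_mul] at h1
    obtain rfl := hi hs hs' h1
    rw [mul_left_inj] at h
    rw [h]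

lemma lower_traj (φ : G →* G) (N : Subgroup G) (hc : N ≤ Subgroup.center G)
    (hφ : N ≤ N.comap φ) {F A R : Set G} (hA : A ⊆ N) (hF : A * R ⊆ F) (n : ℕ) :
    entTraj φ A n * entTraj φ R n ⊆ entTraj φ F n := by
  induction n with
  | zero => simp [entTraj]
  | succ n ih =>
    rintro _ ⟨_, ⟨a, ha, _, ⟨b, hb, rfl⟩, rfl⟩, _, ⟨c, hc', _, ⟨d, hd, rfl⟩, rfl⟩, rfl⟩
    have hz := Subgroup.mem_center_iff.1 (hc (iter_mem φ N hφ n b (hA hb))) c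
    refine ⟨a * c, ih ⟨a, ha, c, hc', rfl⟩, _, ⟨b * d, hF ⟨b, hb, d, hd, rfl⟩, rfl⟩, ?_⟩
    simp only [iterate_map_mul]
    rw [mul_assoc, mul_assoc, ← mul_assoc c, hz, mul_assoc]

lemma upper_traj (φ : G →* G) (N : Subgroup G) (hc : N ≤ Subgroup.center G)
    (hφ : N ≤ N.comap φ) {F S E : Set G} (hE : E ⊆ N) (h1 : (1 : G) ∈ E) (hS : S.Finite) {m : ℕ}
    (hm : 1 ≤ m) (hF : entTraj φ F m ⊆ S * E) (k : ℕ) :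
    ∃ P : Set G, P.Finite ∧ P.ncard ≤ S.ncard ^ k ∧
      entTraj φ F (m * k) ⊆ P * entTraj φ E (m * k) := by
  induction k with
  | zero => exact ⟨{1}, Set.finite_singleton _, by simp, by simp [entTraj]⟩
  | succ k ih =>
    obtain ⟨P, hP, hPc, hPs⟩ := ih
    refine ⟨P * (⇑φ)^[m * k] '' S, hP.mul (hS.image _), ?_, ?_⟩
    · rw [pow_succ]
      exact ncard_mul_le'.trans (Nat.mul_le_mul hPc (Set.ncard_image_le hS))
    · rw [mul_add, mul_one, traj_add]
      rintro _ ⟨x, hx, _, ⟨y, hy, rfl⟩, rfl⟩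
      obtain ⟨p, hp, t, ht, rfl⟩ := hPs hx
      obtain ⟨s, hs, e, he, rfl⟩ := hF hy
      have hz := Subgroup.mem_center_iff.1 (hc (traj_subset_subgroup φ N hφ hE _ ht))
        ((⇑φ)^[m * k] s)
      refine ⟨p * (⇑φ)^[m * k] s, ⟨p, hp, _, ⟨s, hs, rfl⟩, rfl⟩, t * (⇑φ)^[m * k] e,
        traj_mono_nat φ h1 (show m * k + 1 ≤ m * k + m by omega)
          ⟨t, ht, _, ⟨e, he, rfl⟩, rfl⟩, ?_⟩
      simp only [iterate_map_mul]
      rw [mul_assoc, mul_assoc, ← mul_assoc t, ← hz, mul_assoc]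

lemma finite_closure_sub (hG : IsLocallyFinite G) {S : Set G} (hS : S.Finite) :
    ((Subgroup.closure S : Subgroup G) : Set G).Finite := hG S hS

lemma ncard_restrict (φ : G →* G) (N : Subgroup G) (hφ : N ≤ N.comap φ) (E : Set N) (n : ℕ) :
    (entTraj (endRestrict φ N hφ) E n).ncard = (entTraj φ (N.subtype '' E) n).ncard := by
  rw [← traj_image (endRestrict φ N hφ) φ N.subtype (fun x => rfl) E n,
    Set.ncard_image_of_injective _ N.subtype_injective]

lemma lower_main (hG : IsLocallyFinite G) (φ : G →* G)
    (N : Subgroup G) [N.Normal] (hc : N ≤ Subgroup.center G) (hφ : N ≤ N.comap φ)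
    (A : Subgroup N) (hA : (A : Set N).Finite) (B : Subgroup (G ⧸ N))
    (hB : (B : Set (G ⧸ N)).Finite) :
    ∃ F : Subgroup G, (F : Set G).Finite ∧
      entH (endRestrict φ N hφ) A + entH (QuotientGroup.map N N φ hφ) B ≤ entH φ F := by
  set A' : Set G := N.subtype '' (A : Set N) with hA'
  set R : Set G := Quotient.out '' (B : Set (G ⧸ N)) with hR
  have hRB : QuotientGroup.mk' N '' R = B := by
    rw [hR, Set.image_image]
    simp
  have hA'N : A' ⊆ N := by rintro _ ⟨x, _, rfl⟩; exact x.2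
  have hA'f : A'.Finite := hA.image _
  have hRf : R.Finite := hB.image _
  have hFf := hG (A' ∪ R) (hA'f.union hRf)
  refine ⟨Subgroup.closure (A' ∪ R), hFf, ?_⟩
  refine le_of_tendsto_of_tendsto'
    ((entH_tendsto _ A hA).add (entH_tendsto _ B hB)) (entH_tendsto φ _ hFf) ?_
  intro n
  rw [← add_div]
  gcongr
  have p1 := traj_ncard_pos (endRestrict φ N hφ) hA A.one_mem n
  have p2 := traj_ncard_pos (QuotientGroup.map N N φ hφ) hB B.one_mem n
  rw [← Real.log_mul (by positivity) (by positivity)]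
  apply Real.log_le_log (by positivity)
  norm_cast
  rw [ncard_restrict, ← hRB, ← traj_image φ _ (QuotientGroup.mk' N) (fun x => rfl) R n]
  refine (lower_card N (traj_subset_subgroup φ N hφ hA'N n) (traj_finite φ hA'f n)
    (traj_finite φ hRf n)).trans (Set.ncard_le_ncard ?_ (traj_finite φ hFf n))
  apply lower_traj φ N hc hφ hA'N
  rintro _ ⟨a, ha, b, hb, rfl⟩
  exact Subgroup.mul_mem _ (Subgroup.subset_closure (Or.inl ha))
    (Subgroup.subset_closure (Or.inr hb))

lemma upper_main (hG : IsLocallyFinite G) (φ : G →* G)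
    (N : Subgroup G) [N.Normal] (hc : N ≤ Subgroup.center G) (hφ : N ≤ N.comap φ)
    (F : Subgroup G) (hF : (F : Set G).Finite) (m : ℕ) (hm : 1 ≤ m) :
    ∃ E : Subgroup N, (E : Set N).Finite ∧
      entH φ F ≤ entH (endRestrict φ N hφ) E +
        Real.log (entTraj (QuotientGroup.map N N φ hφ)
          ((F.map (QuotientGroup.mk' N) : Subgroup (G ⧸ N)) : Set (G ⧸ N)) m).ncard / m := by
  obtain ⟨S, hSA, hi, him, hcard⟩ := exists_section N (traj_finite φ hF m)
  have hSf : S.Finite := (traj_finite φ hF m).subset hSA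
  set E0 : Set G := (S⁻¹ * entTraj φ F m) ∩ N with hE0
  have hE0f : E0.Finite := (hSf.inv.mul (traj_finite φ hF m)).inter_of_left _
  have hle : Subgroup.closure E0 ≤ N := (Subgroup.closure_le N).2 Set.inter_subset_right
  set E : Subgroup N := (Subgroup.closure E0).subgroupOf N with hE
  have hEimg : N.subtype '' (E : Set N) = Subgroup.closure E0 := by
    rw [← Subgroup.coe_map, hE, Subgroup.subgroupOf_map_subtype, inf_eq_left.2 hle]
  have hEf : (E : Set N).Finite :=
    Set.Finite.of_finite_image (hEimg ▸ hG E0 hE0f) N.subtype_injective.injOn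
  refine ⟨E, hEf, ?_⟩
  have hsub : entTraj φ F m ⊆ S * (Subgroup.closure E0 : Set G) := by
    intro x hx
    have : QuotientGroup.mk' N x ∈ QuotientGroup.mk' N '' S := him ▸ ⟨x, hx, rfl⟩
    obtain ⟨s, hs, hsx⟩ := this
    refine ⟨s, hs, s⁻¹ * x, Subgroup.subset_closure ⟨⟨s⁻¹, by simpa using hs, x, hx, rfl⟩, ?_⟩,
      by simp⟩
    exact QuotientGroup.eq.1 hsx
  have htop : Filter.Tendsto (fun k : ℕ => m * k) Filter.atTop Filter.atTop :=
    Filter.tendsto_id.const_mul_atTop' (by omega)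
  have t1 := (entH_tendsto φ F hF).comp htop
  have t2 := ((entH_tendsto (endRestrict φ N hφ) E hEf).comp htop).add_const
    (Real.log (entTraj (QuotientGroup.map N N φ hφ)
          ((F.map (QuotientGroup.mk' N) : Subgroup (G ⧸ N)) : Set (G ⧸ N)) m).ncard / m)
  refine le_of_tendsto_of_tendsto t1 t2 ?_
  filter_upwards [Filter.eventually_ge_atTop 1] with k hk
  obtain ⟨P, hPf, hPc, hPs⟩ := upper_traj φ N hc hφ (F := F) (E := Subgroup.closure E0) hle
    (Subgroup.one_mem _) hSf hm hsub k
  have hcard2 : S.ncard = (entTraj (QuotientGroup.map N N φ hφ)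
          ((F.map (QuotientGroup.mk' N) : Subgroup (G ⧸ N)) : Set (G ⧸ N)) m).ncard := by
    rw [hcard, traj_image φ (QuotientGroup.map N N φ hφ) (QuotientGroup.mk' N) (fun x => rfl),
      Subgroup.coe_map]
  rw [← hcard2]
  have hk0 : (0 : ℝ) < k := by exact_mod_cast hk
  have hm0 : (0 : ℝ) < m := by exact_mod_cast hm
  have hT := traj_ncard_pos (endRestrict φ N hφ) hEf E.one_mem (m * k)
  have hTF := traj_ncard_pos φ hF F.one_mem (m * k)
  have hS0 : 0 < S.ncard := by
    rw [hcard]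
    exact (Set.ncard_pos ((traj_finite φ hF m).image _)).2
      ⟨_, 1, traj_one_mem φ F.one_mem m, rfl⟩
  have key : (entTraj φ F (m * k)).ncard ≤
      S.ncard ^ k * (entTraj (endRestrict φ N hφ) E (m * k)).ncard := by
    rw [ncard_restrict, hEimg]
    exact ((Set.ncard_le_ncard hPs (hPf.mul (traj_finite φ (hG E0 hE0f) _))).trans
      ncard_mul_le').trans (Nat.mul_le_mul_right _ hPc)
  have key2 : Real.log (entTraj φ F (m * k)).ncard ≤
      k * Real.log S.ncard + Real.log (entTraj (endRestrict φ N hφ) E (m * k)).ncard := by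
    rw [← Real.log_pow, ← Real.log_mul (by positivity) (by positivity)]
    apply Real.log_le_log (by exact_mod_cast hTF)
    exact_mod_cast key
  simp only [Function.comp_apply]
  have e : Real.log S.ncard / m = k * Real.log S.ncard / ((m * k : ℕ) : ℝ) := by
    push_cast
    field_simp
  rw [e, ← add_div, add_comm]
  gcongr

end aux

end AlgEntropy

theorem algEnt_eq_central {G : Type*} [Group G] (hG : IsLocallyFinite G) (φ : G →* G)
    (N : Subgroup G) (hc : N ≤ Subgroup.center G) (hφ : N ≤ N.comap φ) :
    AlgEntropy.algEnt φ =
      AlgEntropy.algEnt (AlgEntropy.endRestrict φ N hφ) +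
        AlgEntropy.entQuot φ N (AlgEntropy.normal_of_le_center hc) hφ := by
  haveI : N.Normal := AlgEntropy.normal_of_le_center hc
  change _ = _ + AlgEntropy.algEnt (QuotientGroup.map N N φ hφ)
  apply le_antisymm
  · refine iSup₂_le fun F hF => ?_
    have hBf : ((F.map (QuotientGroup.mk' N) : Subgroup (G ⧸ N)) : Set (G ⧸ N)).Finite := by
      rw [Subgroup.coe_map]; exact hF.image _
    have t := (ENNReal.continuous_ofReal.tendsto _).comp
      (AlgEntropy.entH_tendsto (QuotientGroup.map N N φ hφ) _ hBf)
    have t2 := (tendsto_const_nhds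
      (x := AlgEntropy.algEnt (AlgEntropy.endRestrict φ N hφ))).add t
    refine (ge_of_tendsto t2 ?_).trans
      (add_le_add le_rfl (le_iSup₂ (f := fun (B : Subgroup (G ⧸ N))
        (_ : (B : Set (G ⧸ N)).Finite) =>
        ENNReal.ofReal (AlgEntropy.entH (QuotientGroup.map N N φ hφ) B)) _ hBf))
    filter_upwards [Filter.eventually_ge_atTop 1] with m hm
    obtain ⟨E, hE, h⟩ := AlgEntropy.upper_main hG φ N hc hφ F hF m hm
    refine (ENNReal.ofReal_le_ofReal h).trans (ENNReal.ofReal_add_le.trans ?_)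
    exact add_le_add (le_iSup₂ (f := fun (B : Subgroup N)
        (_ : (B : Set N).Finite) =>
        ENNReal.ofReal (AlgEntropy.entH (AlgEntropy.endRestrict φ N hφ) B)) E hE) le_rfl
  · refine ENNReal.biSup_add_biSup_le' ⟨⊥, by simp⟩ ⟨⊥, by simp⟩ fun A hA B hB => ?_
    obtain ⟨F, hF, h⟩ := AlgEntropy.lower_main hG φ N hc hφ A hA B hB
    have nn : ∀ {K : Type _} [Group K] (ψ : K →* K) (L : Subgroup K)
        (_ : (L : Set K).Finite), 0 ≤ AlgEntropy.entH ψ L := fun ψ L hL =>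
      ge_of_tendsto' (AlgEntropy.entH_tendsto ψ L hL) fun n =>
        div_nonneg (Real.log_natCast_nonneg _) (Nat.cast_nonneg _)
    rw [← ENNReal.ofReal_add (nn _ _ hA) (nn _ _ hB)]
    exact (ENNReal.ofReal_le_ofReal h).trans
      (le_iSup₂ (f := fun (B : Subgroup G) (_ : (B : Set G).Finite) =>
        ENNReal.ofReal (AlgEntropy.entH φ B)) F hF)
end

section
/- Let G be a torsion nilpotent group and let g ∈ G. Then the inner automorphism ι_g : G → G defined by ι_g(x) = g⁻¹xg has zero algebraic entropy: h(ι_g) = 0. -/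
open scoped Pointwise ENNReal

theorem finite_of_fg_tors_solv {K : Type*} [Group K] [Group.FG K] (ht : Monoid.IsTorsion K)
    [Group.IsSolvable K] : Finite K := by
  have key : ∀ n, (derivedSeries K n).FiniteIndex := by
    intro n
    induction n with
    | zero => simp only [derivedSeries_zero]; infer_instance
    | succ n ih =>
      haveI := ih
      set H := derivedSeries K n with hH
      haveI : Group.FG H := inferInstance
      have htH : Monoid.IsTorsion (Abelianization H) :=
        (ht.subgroup H).of_surjective (f := Abelianization.of) (QuotientGroup.mk'_surjective _)
      haveI : Group.FG (Abelianization H) := QuotientGroup.fg _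
      haveI : Finite (Abelianization H) := CommGroup.finite_of_fg_isMulTorsion _ htH
      haveI : Finite (H ⧸ commutator H) := this
      haveI : (commutator H).FiniteIndex := Subgroup.finiteIndex_of_finite_quotient
      have e : derivedSeries K (n+1) = (commutator H).map H.subtype := by
        rw [derivedSeries_succ, commutator_def, Subgroup.map_commutator, ← MonoidHom.range_eq_map,
          Subgroup.range_subtype]
      rw [e]
      constructor
      rw [Subgroup.index_map_subtype]
      exact mul_ne_zero Subgroup.FiniteIndex.index_ne_zero Subgroup.FiniteIndex.index_ne_zero
  obtain ⟨n, hn⟩ := (Group.isSolvable_def K).1 inferInstance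
  have := key n
  rw [hn] at this
  have h := this.index_ne_zero
  rw [Subgroup.index_bot] at h
  exact Nat.finite_of_card_ne_zero h

theorem entTraj_subset {G : Type*} [Group G] (φ : G →* G) (F : Set G) (K : Subgroup G)
    (hF : F ⊆ K) (hK : ∀ x ∈ K, φ x ∈ K) (n : ℕ) : AlgEntropy.entTraj φ F n ⊆ K := by
  have hit : ∀ (n : ℕ) (x : G), x ∈ K → (⇑φ)^[n] x ∈ K := by
    intro n
    induction n with
    | zero => intro x hx; exact hx
    | succ n ih => intro x hx; rw [Function.iterate_succ_apply]; exact ih _ (hK x hx)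
  induction n with
  | zero => intro x hx; rw [AlgEntropy.entTraj, Set.mem_singleton_iff] at hx; subst hx; exact K.one_mem
  | succ n ih =>
    intro x hx
    obtain ⟨a, ha, b, ⟨c, hc, rfl⟩, rfl⟩ := hx
    exact K.mul_mem (ih ha) (hit n c (hF hc))

/-- In a torsion nilpotent group the inner automorphism
`ι_g : x ↦ g⁻¹ x g` has zero algebraic entropy. -/
theorem algEnt_inner_eq_zero {G : Type*} [Group G] (htor : Monoid.IsTorsion G)
    [Group.IsNilpotent G] (g : G) :
    AlgEntropy.algEnt (MulAut.conj g⁻¹).toMonoidHom = 0 := by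
  refine le_antisymm (iSup₂_le fun F hF => ?_) bot_le
  set K := Subgroup.closure ((F : Set G) ∪ {g}) with hKdef
  haveI : Group.FG K := (Group.fg_iff_subgroup_fg K).2
    ((Subgroup.fg_iff K).2 ⟨_, rfl, hF.union (Set.finite_singleton g)⟩)
  haveI : Finite K := finite_of_fg_tors_solv (htor.subgroup K)
  have hKf : (K : Set G).Finite := Set.toFinite _
  have hg : g ∈ K := Subgroup.subset_closure (Or.inr rfl)
  have hsub := entTraj_subset (MulAut.conj g⁻¹).toMonoidHom F K
    (fun x hx => Subgroup.subset_closure (Or.inl hx))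
    (fun x hx => by
      simpa using K.mul_mem (K.mul_mem (K.inv_mem hg) hx) hg)
  have hlim : Filter.Tendsto (fun n : ℕ => Real.log
      (AlgEntropy.entTraj (MulAut.conj g⁻¹).toMonoidHom (F : Set G) n).ncard / n)
      Filter.atTop (nhds 0) := by
    refine squeeze_zero (fun n => div_nonneg (Real.log_natCast_nonneg _) n.cast_nonneg) (fun n => ?_)
      (tendsto_const_div_atTop_nhds_zero_nat (Real.log (K : Set G).ncard))
    gcongr ?_ / _
    rcases Nat.eq_zero_or_pos
      (AlgEntropy.entTraj (MulAut.conj g⁻¹).toMonoidHom (F : Set G) n).ncard with h | h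
    · rw [h]; simpa using Real.log_natCast_nonneg _
    · exact Real.log_le_log (by exact_mod_cast h)
        (by exact_mod_cast Set.ncard_le_ncard (hsub n) hKf)
  rw [AlgEntropy.entH, hlim.limsup_eq]
  simp
end

section
/- Let G be a locally finite group, let φ be an endomorphism of G, and let {G_i}_{i∈I} be a directed family of φ-invariant subgroups of G (directed by inclusion) such that G = ⋃_{i∈I} G_i. Then h(φ) = sup_{i∈I} h(φ↾_{G_i}). -/
open scoped Pointwise ENNReal

namespace AlgEntropy

lemma endRestrict_iter {G : Type*} [Group G] (φ : G →* G) (H : Subgroup G)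
    (hH : H ≤ H.comap φ) (n : ℕ) (x : H) :
    (((⇑(endRestrict φ H hH))^[n] x : H) : G) = (⇑φ)^[n] (x : G) := by
  induction n generalizing x with
  | zero => rfl
  | succ n ih =>
    rw [Function.iterate_succ_apply, Function.iterate_succ_apply, ih]
    rfl

lemma entTraj_restrict {G : Type*} [Group G] (φ : G →* G) (H : Subgroup G)
    (hH : H ≤ H.comap φ) (F : Set H) (n : ℕ) :
    entTraj φ (H.subtype '' F) n = H.subtype '' entTraj (endRestrict φ H hH) F n := by
  induction n with
  | zero => simp [entTraj]
  | succ n ih =>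
    simp only [entTraj]
    rw [ih, Set.image_mul, Set.image_image, Set.image_image]
    congr 1
    apply Set.image_congr
    intro x _
    exact (endRestrict_iter φ H hH n x).symm

lemma entH_restrict {G : Type*} [Group G] (φ : G →* G) (H : Subgroup G)
    (hH : H ≤ H.comap φ) (F : Subgroup H) :
    entH φ (F.map H.subtype) = entH (endRestrict φ H hH) F := by
  unfold entH
  rw [Subgroup.coe_map]
  simp only [entTraj_restrict φ H hH, Set.ncard_image_of_injective _ H.subtype_injective]

end AlgEntropy

/-- If a locally finite group `G` is the union of a directed family
of `φ`-invariant subgroups `G_i`, then `h(φ) = sup_i h(φ↾_{G_i})`. -/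
theorem algEnt_eq_iSup_directed {G : Type*} [Group G] (hG : IsLocallyFinite G)
    (φ : G →* G) {ι : Type*} (Gf : ι → Subgroup G) (hdir : Directed (· ≤ ·) Gf)
    (hinv : ∀ i, Gf i ≤ (Gf i).comap φ) (hunion : ∀ g : G, ∃ i, g ∈ Gf i) :
    AlgEntropy.algEnt φ =
      ⨆ i, AlgEntropy.algEnt (AlgEntropy.endRestrict φ (Gf i) (hinv i)) := by
  apply le_antisymm
  · refine iSup₂_le fun F hF => ?_
    have : Nonempty ι := ⟨(hunion 1).choose⟩
    have hsub : (F : Set G) ⊆ ⋃ i, (Gf i : Set G) := fun g _ => Set.mem_iUnion.2 (hunion g)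
    have hd : Directed (· ⊆ ·) (fun i => (Gf i : Set G)) := hdir
    obtain ⟨i, hi⟩ := hd.exists_mem_subset_of_finset_subset_biUnion (s := hF.toFinset)
      (by rw [hF.coe_toFinset]; exact hsub)
    rw [hF.coe_toFinset] at hi
    have hle : F ≤ Gf i := hi
    have e : (F.subgroupOf (Gf i)).map (Gf i).subtype = F :=
      Subgroup.map_subgroupOf_eq_of_le hle
    refine le_trans ?_ (le_iSup _ i)
    have hfin : ((F.subgroupOf (Gf i) : Subgroup (Gf i)) : Set (Gf i)).Finite :=
      Set.Finite.preimage (f := (Gf i).subtype) (Gf i).subtype_injective.injOn hF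
    refine le_trans ?_ (le_iSup₂ (F.subgroupOf (Gf i)) hfin)
    rw [← AlgEntropy.entH_restrict, e]
  · refine iSup_le fun i => iSup₂_le fun F hF => ?_
    rw [← AlgEntropy.entH_restrict]
    exact le_iSup₂ (f := fun (F : Subgroup G) (_ : (F : Set G).Finite) =>
      ENNReal.ofReal (AlgEntropy.entH φ F)) (F.map (Gf i).subtype) (hF.image _)
end

section
/- Let G be a locally finite group and let {G_i}_{i∈I} be a chain (a family totally ordered by inclusion) of subgroups of G with G = ⋃_{i∈I} G_i. Assume that each G_i is fully characteristic in G (invariant under every endomorphism of G) and that for every i ∈ I the Addition Theorem holds for G_i for endomorphisms, i.e. AT(G_i, ψ, K) holds for every endomorphism ψ of G_i and every ψ-invariant normal subgroup K of G_i. Then the Addition Theorem holds for G for endomorphisms: for every endomorphism φ of G and every φ-invariant normal subgroup H of G, h(φ) = h(φ↾_H) + h(φ̄), where φ̄ is the endomorphism induced by φ on G/H. -/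
open scoped Pointwise ENNReal

namespace AlgEntropy

lemma entTraj_map {A B : Type*} [Group A] [Group B] (α : A →* A) (β : B →* B) (f : A →* B)
    (hf : ∀ a, f (α a) = β (f a)) (F : Set A) (n : ℕ) :
    entTraj β (f '' F) n = f '' entTraj α F n := by
  induction n with
  | zero => simp [entTraj]
  | succ n ih =>
    have hs : Function.Semiconj f α β := hf
    simp only [entTraj]
    rw [ih, Set.image_mul, Set.image_image, Set.image_image]
    congr 1
    exact Set.image_congr fun x _ => ((hs.iterate_right n) x).symm

lemma entH_map {A B : Type*} [Group A] [Group B] (α : A →* A) (β : B →* B) (f : A →* B)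
    (hi : Function.Injective f)
    (hf : ∀ a, f (α a) = β (f a)) (F : Subgroup A) :
    entH β (F.map f) = entH α F := by
  unfold entH
  simp only [Subgroup.coe_map, entTraj_map α β f hf, Set.ncard_image_of_injective _ hi]

lemma entH_le_of_range {A B : Type*} [Group A] [Group B] (α : A →* A) (β : B →* B) (f : A →* B)
    (hi : Function.Injective f)
    (hf : ∀ a, f (α a) = β (f a)) (F : Subgroup B) (hF : (F : Set B).Finite)
    (hr : F ≤ f.range) : ENNReal.ofReal (entH β F) ≤ algEnt α := by
  have h1 : (F.comap f).map f = F := by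
    rw [Subgroup.map_comap_eq, inf_eq_right.2 hr]
  rw [← h1, entH_map α β f hi hf]
  exact le_iSup₂_of_le (F.comap f) (by rw [Subgroup.coe_comap]; exact hF.preimage hi.injOn) le_rfl

lemma algEnt_le_of_inj {A B : Type*} [Group A] [Group B] (α : A →* A) (β : B →* B) (f : A →* B)
    (hi : Function.Injective f)
    (hf : ∀ a, f (α a) = β (f a)) : algEnt α ≤ algEnt β := by
  refine iSup₂_le fun F hF => ?_
  rw [← entH_map α β f hi hf]
  exact le_iSup₂_of_le (F.map f) (by rw [Subgroup.coe_map]; exact hF.image f) le_rfl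

lemma algEnt_mono_range {A A' B : Type*} [Group A] [Group A'] [Group B] (α : A →* A)
    (α' : A' →* A') (β : B →* B) (f : A →* B) (f' : A' →* B)
    (hi : Function.Injective f) (hf : ∀ a, f (α a) = β (f a))
    (hi' : Function.Injective f') (hf' : ∀ a, f' (α' a) = β (f' a))
    (hr : f.range ≤ f'.range) : algEnt α ≤ algEnt α' := by
  refine iSup₂_le fun F hF => ?_
  rw [← entH_map α β f hi hf]
  refine entH_le_of_range α' β f' hi' hf' _ (by rw [Subgroup.coe_map]; exact hF.image f) ?_
  exact (Subgroup.map_le_range f F).trans hr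

lemma algEnt_eq_iSup {ι : Type*} [Nonempty ι] {A : ι → Type*} {B : Type*} [∀ i, Group (A i)]
    [Group B] (α : ∀ i, A i →* A i) (β : B →* B) (f : ∀ i, A i →* B)
    (hi : ∀ i, Function.Injective (f i)) (hf : ∀ i a, f i (α i a) = β (f i a))
    (hc : ∀ i j, (f i).range ≤ (f j).range ∨ (f j).range ≤ (f i).range)
    (hu : ∀ b, ∃ i, b ∈ (f i).range) : algEnt β = ⨆ i, algEnt (α i) := by
  apply le_antisymm
  · refine iSup₂_le fun F hF => ?_
    have key : ∀ S : Set B, S.Finite → ∃ i, S ⊆ (f i).range := by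
      intro S hS
      induction S, hS using Set.Finite.induction_on with
      | empty => exact ⟨Classical.arbitrary ι, Set.empty_subset _⟩
      | insert _ _ ih =>
        rename_i b T _ _
        obtain ⟨i, h1⟩ := ih
        obtain ⟨j, h2⟩ := hu b
        rcases hc i j with h | h
        · exact ⟨j, Set.insert_subset h2 (h1.trans h)⟩
        · exact ⟨i, Set.insert_subset (h h2) h1⟩
    obtain ⟨i, h⟩ := key F hF
    exact (entH_le_of_range (α i) β (f i) (hi i) (hf i) F hF h).trans
      (le_iSup (fun i => algEnt (α i)) i)
  · exact iSup_le fun i => algEnt_le_of_inj (α i) β (f i) (hi i) (hf i)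

end AlgEntropy

/-- Reduction along chains, endomorphisms. Let `G` be a locally
finite group which is the union of a chain of fully characteristic subgroups `G_i`.
If the Addition Theorem holds for each `G_i` for endomorphisms, then it holds for `G`
for endomorphisms. -/
theorem AT_of_chain_endo {G : Type*} [Group G] (hG : IsLocallyFinite G)
    {ι : Type*} (Gf : ι → Subgroup G)
    (hchain : ∀ i j, Gf i ≤ Gf j ∨ Gf j ≤ Gf i)
    (hunion : ∀ g : G, ∃ i, g ∈ Gf i)
    (hfc : ∀ (i : ι) (ψ : G →* G), Gf i ≤ (Gf i).comap ψ)
    (hATi : ∀ (i : ι) (ψ : ↥(Gf i) →* ↥(Gf i)) (K : Subgroup ↥(Gf i))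
      (hK : K.Normal) (hKψ : K ≤ K.comap ψ), AlgEntropy.AT ψ K hK hKψ)
    (φ : G →* G) (H : Subgroup G) (hN : H.Normal) (hH : H ≤ H.comap φ) :
    AlgEntropy.AT φ H hN hH := by
  haveI := hN
  haveI : Nonempty ι := ⟨(hunion 1).choose⟩
  let φi : ∀ i, Gf i →* Gf i := fun i => AlgEntropy.endRestrict φ (Gf i) (hfc i φ)
  let K : ∀ i, Subgroup (Gf i) := fun i => H.subgroupOf (Gf i)
  have hKN : ∀ i, (K i).Normal := fun i => inferInstanceAs (H.subgroupOf (Gf i)).Normal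
  have hK : ∀ i, K i ≤ (K i).comap (φi i) := fun i x hx => hH hx
  -- the group itself
  have e1 : AlgEntropy.algEnt φ = ⨆ i, AlgEntropy.algEnt (φi i) := by
    refine AlgEntropy.algEnt_eq_iSup φi φ (fun i => (Gf i).subtype)
      (fun i => Subtype.val_injective) (fun i a => rfl) ?_ ?_
    · simpa using hchain
    · simpa using hunion
  -- the subgroup
  let fH : ∀ i, K i →* H := fun i =>
    { toFun := fun x => ⟨x.1.1, x.2⟩, map_one' := rfl, map_mul' := fun _ _ => rfl }
  have fHi : ∀ i, Function.Injective (fH i) := fun i x y h =>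
    Subtype.ext (Subtype.ext (congrArg (fun z : H => (z : G)) h))
  have fHr : ∀ i (x : H), x ∈ (fH i).range ↔ (x : G) ∈ Gf i := by
    intro i x
    constructor
    · rintro ⟨y, rfl⟩
      exact y.1.2
    · intro h
      exact ⟨⟨⟨x, h⟩, x.2⟩, rfl⟩
  have fHm : ∀ i j, Gf i ≤ Gf j → (fH i).range ≤ (fH j).range := fun i j h x hx =>
    (fHr j x).2 (h ((fHr i x).1 hx))
  let ψ : ∀ i, K i →* K i := fun i => AlgEntropy.endRestrict (φi i) (K i) (hK i)
  have fHe : ∀ i a, fH i (ψ i a) = AlgEntropy.endRestrict φ H hH (fH i a) := fun i a => rfl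
  have e2 : AlgEntropy.algEnt (AlgEntropy.endRestrict φ H hH) = ⨆ i, AlgEntropy.algEnt (ψ i) := by
    refine AlgEntropy.algEnt_eq_iSup ψ _ fH fHi fHe
      (fun i j => (hchain i j).imp (fHm i j) (fHm j i)) ?_
    intro b
    obtain ⟨i, h⟩ := hunion b
    exact ⟨i, (fHr i b).2 h⟩
  -- the quotient
  let fQ : ∀ i, (Gf i ⧸ K i) →* G ⧸ H := fun i =>
    QuotientGroup.map (K i) H (Gf i).subtype (fun x hx => hx)
  have fQi : ∀ i, Function.Injective (fQ i) := by
    intro i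
    rw [injective_iff_map_eq_one]
    intro a
    induction a using QuotientGroup.induction_on with
    | H z =>
      intro h
      exact (QuotientGroup.eq_one_iff z).2 ((QuotientGroup.eq_one_iff (z : G)).1 h)
  let χ : ∀ i, (Gf i ⧸ K i) →* (Gf i ⧸ K i) := fun i =>
    QuotientGroup.map (K i) (K i) (φi i) (hK i)
  have fQe : ∀ i a, fQ i (χ i a) = QuotientGroup.map H H φ hH (fQ i a) := by
    intro i a
    induction a using QuotientGroup.induction_on with
    | H z => rfl
  have fQm : ∀ i j, Gf i ≤ Gf j → (fQ i).range ≤ (fQ j).range := by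
    rintro i j h _ ⟨a, rfl⟩
    induction a using QuotientGroup.induction_on with
    | H z => exact ⟨((⟨z, h z.2⟩ : Gf j) : Gf j ⧸ K j), rfl⟩
  have e3 : AlgEntropy.entQuot φ H hN hH = ⨆ i, AlgEntropy.algEnt (χ i) := by
    refine AlgEntropy.algEnt_eq_iSup χ _ fQ fQi fQe
      (fun i j => (hchain i j).imp (fQm i j) (fQm j i)) ?_
    intro b
    induction b using QuotientGroup.induction_on with
    | H z =>
      obtain ⟨i, h⟩ := hunion z
      exact ⟨i, ((⟨z, h⟩ : Gf i) : Gf i ⧸ K i), rfl⟩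
  have e4 : ∀ i, AlgEntropy.algEnt (φi i) = AlgEntropy.algEnt (ψ i) + AlgEntropy.algEnt (χ i) :=
    fun i => hATi i (φi i) (K i) (hKN i) (hK i)
  unfold AlgEntropy.AT
  rw [e1, e2, e3, ENNReal.iSup_add_iSup]
  · exact iSup_congr e4
  · intro i j
    rcases hchain i j with h | h
    · exact ⟨j, add_le_add_left (AlgEntropy.algEnt_mono_range _ _ _ (fH i) (fH j) (fHi i) (fHe i)
        (fHi j) (fHe j) (fHm i j h)) _⟩
    · exact ⟨i, add_le_add_right (AlgEntropy.algEnt_mono_range _ _ _ (fQ j) (fQ i) (fQi j) (fQe j)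
        (fQi i) (fQe i) (fQm j i h)) _⟩
end
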